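/- For any Boolean function f : {0,1}^n → {0,1} that is not constantly 1, C_1(f) ≥ (3/2)·bs_0(f)/s_0(f) − 1/2, where C_1 is the maximum over 1-inputs of the minimum size of a 1-certificate, bs_0 is the maximum block sensitivity over 0-inputs, and s_0 is the maximum sensitivity over 0-inputs. -/

import Mathlib

open Finset

section Defs

variable {I : Type*} [Fintype I] [DecidableEq I]

/-- Flip a single bit of the input. -/
def flipBit (x : I → Bool) (i : I) : I → Bool := Function.update x i (!(x i))

/-- Flip a block of bits of the input. -/
def flipSet (x : I → Bool) (B : Finset I) : I → Bool := fun j => if j ∈ B then !(x j) else x j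

/-- Sensitivity of `f` at input `x`. -/
def sens (f : (I → Bool) → Bool) (x : I → Bool) : ℕ :=
  (univ.filter fun i => f (flipBit x i) ≠ f x).card

/-- Maximum sensitivity over 0-inputs. -/
noncomputable def s0 (f : (I → Bool) → Bool) : ℕ :=
  (univ.filter fun x => f x = false).sup (sens f)

/-- Maximum sensitivity over 1-inputs. -/
noncomputable def s1 (f : (I → Bool) → Bool) : ℕ :=
  (univ.filter fun x => f x = true).sup (sens f)

/-- There exist `b` pairwise disjoint sensitive blocks for `f` at `x`. -/
def hasBS (f : (I → Bool) → Bool) (x : I → Bool) (b : ℕ) : Prop :=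
  ∃ B : Fin b → Finset I, (∀ i j, i ≠ j → Disjoint (B i) (B j)) ∧
    ∀ i, f (flipSet x (B i)) ≠ f x

/-- Block sensitivity of `f` at `x`. -/
noncomputable def bs (f : (I → Bool) → Bool) (x : I → Bool) : ℕ := sSup {b | hasBS f x b}

/-- Maximum block sensitivity over 0-inputs. -/
noncomputable def bs0 (f : (I → Bool) → Bool) : ℕ :=
  (univ.filter fun x => f x = false).sup (bs f)

/-- `y` agrees with `x` on the set `S`. -/
def agreesOn (S : Finset I) (x y : I → Bool) : Prop := ∀ i ∈ S, y i = x i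

/-- The restriction of `x` to `S` forces the value `v`. -/
def IsCertOn (f : (I → Bool) → Bool) (S : Finset I) (x : I → Bool) (v : Bool) : Prop :=
  ∀ y, agreesOn S x y → f y = v

/-- Minimum size of a certificate of `f` at `x` (for the value `f x`). -/
noncomputable def certSize (f : (I → Bool) → Bool) (x : I → Bool) : ℕ :=
  sInf {m | ∃ S : Finset I, S.card = m ∧ IsCertOn f S x (f x)}

/-- Maximum certificate complexity over 1-inputs. -/
noncomputable def C1 (f : (I → Bool) → Bool) : ℕ :=
  (univ.filter fun x => f x = true).sup (certSize f)

/-- `x` satisfies the partial assignment `c`. -/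
def PAsat (c : I → Option Bool) (x : I → Bool) : Prop := ∀ i b, c i = some b → x i = b

/-- The partial assignment `c` is a 1-certificate of `f`. -/
def IsOneCert (f : (I → Bool) → Bool) (c : I → Option Bool) : Prop :=
  ∀ x, PAsat c x → f x = true

/-- The partial assignment `c` is a minimal 1-certificate of `f`. -/
def IsMinOneCert (f : (I → Bool) → Bool) (c : I → Option Bool) : Prop :=
  IsOneCert f c ∧ ∀ i, c i ≠ none → ¬ IsOneCert f (Function.update c i none)

/-- Number of positions assigned by a partial assignment. -/
def PAsize (c : I → Option Bool) : ℕ := (univ.filter fun i => c i ≠ none).card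

/-- Two partial assignments overlap: some position is assigned the same value by both. -/
def Overlap (c d : I → Option Bool) : Prop := ∃ i b, c i = some b ∧ d i = some b

/-- Number of contradictions between two partial assignments. -/
def contra (c d : I → Option Bool) : ℕ :=
  (univ.filter fun i =>
    (c i = some true ∧ d i = some false) ∨ (c i = some false ∧ d i = some true)).card

end Defs

/-- Total weight of the induced subgraph on `A` (each unordered edge counted once). -/
def gweight {V : Type*} [DecidableEq V] (w : V → V → ℕ) (A : Finset V) : ℚ :=
  (∑ p ∈ A.offDiag, (w p.1 p.2 : ℚ)) / 2

/-- Weighted Turan-type theorem for sets inducing maximum degree at most two. -/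
lemma turan_two {V : Type*} [DecidableEq V] (w : V → V → ℕ) (hs : ∀ i j, w i j = w j i)
    (hd : ∀ i, w i i = 0) (S : Finset V) :
    ∃ A ⊆ S, (∀ i ∈ A, ∑ j ∈ A, w i j ≤ 2) ∧
      3 * S.card ^ 2 ≤ A.card * ((∑ i ∈ S, ∑ j ∈ S, w i j) + 3 * S.card) := by
  induction S using Finset.strongInduction with
  | H S ih =>
  rcases S.eq_empty_or_nonempty with rfl | hne
  · exact ⟨∅, by simp⟩
  obtain ⟨A, hA, hmin⟩ := Finset.exists_min_image S.powerset
    (fun A => ((∑ i ∈ A, ∑ j ∈ A, w i j : ℕ) : ℤ) - 5 * A.card) ⟨∅, by simp⟩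
  rw [mem_powerset] at hA
  have hins : ∀ (C : Finset V) (v : V), v ∉ C →
      (∑ i ∈ insert v C, ∑ j ∈ insert v C, w i j)
        = (∑ i ∈ C, ∑ j ∈ C, w i j) + 2 * ∑ j ∈ C, w v j := by
    intro C v hv
    rw [sum_insert hv, sum_insert hv, hd]
    have : ∀ i ∈ C, ∑ j ∈ insert v C, w i j = w v i + ∑ j ∈ C, w i j := by
      intro i _
      rw [sum_insert hv, hs i v]
    rw [sum_congr rfl this, sum_add_distrib]
    ring
  have h1 : ∀ i ∈ A, ∑ j ∈ A, w i j ≤ 2 := by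
    intro i hi
    have h := hmin (A.erase i) (mem_powerset.2 ((erase_subset _ _).trans hA))
    have h2 := hins (A.erase i) i (notMem_erase _ _)
    have hc := card_erase_add_one hi
    rw [insert_erase hi] at h2
    have h3 : ∑ j ∈ A, w i j = ∑ j ∈ A.erase i, w i j := by
      rw [← add_sum_erase A _ hi, hd, zero_add]
    rw [h3]
    rw [h2] at h
    omega
  have h2 : ∀ i ∈ S \ A, 3 ≤ ∑ j ∈ A, w i j := by
    intro i hi
    rw [mem_sdiff] at hi
    have h := hmin (insert i A) (mem_powerset.2 (insert_subset hi.1 hA))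
    have h2 := hins A i hi.2
    have hc := card_insert_of_notMem hi.2
    rw [h2, hc] at h
    omega
  by_cases hgood : 3 * S.card ^ 2 ≤ A.card * ((∑ i ∈ S, ∑ j ∈ S, w i j) + 3 * S.card)
  · exact ⟨A, hA, h1, hgood⟩
  have hAne : A.Nonempty := by
    by_contra hcon
    rw [not_nonempty_iff_eq_empty] at hcon
    subst hcon
    obtain ⟨v, hv⟩ := hne
    have := h2 v (by simpa using hv)
    simp at this
  have hss : S \ A ⊂ S := sdiff_ssubset hA hAne
  obtain ⟨A', hA', hdeg, hcard⟩ := ih _ hss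
  refine ⟨A', hA'.trans sdiff_subset, hdeg, ?_⟩
  have hcs : (S \ A).card + A.card = S.card := card_sdiff_add_card_eq_card hA
  have hRR : (∑ i ∈ S \ A, ∑ j ∈ S \ A, w i j) + 6 * (S \ A).card
      ≤ ∑ i ∈ S, ∑ j ∈ S, w i j := by
    have e : ∀ g : V → ℕ, ∑ i ∈ S, g i = ∑ i ∈ S \ A, g i + ∑ i ∈ A, g i :=
      fun g => (sum_sdiff hA).symm
    have e1 : ∑ i ∈ S, ∑ j ∈ S, w i j = (∑ i ∈ S \ A, ∑ j ∈ S \ A, w i j)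
        + (∑ i ∈ S \ A, ∑ j ∈ A, w i j) + ((∑ i ∈ A, ∑ j ∈ S \ A, w i j)
        + ∑ i ∈ A, ∑ j ∈ A, w i j) := by
      rw [e, ← sum_add_distrib, ← sum_add_distrib]
      congr 1 <;> exact sum_congr rfl (fun i _ => e _)
    have e2 : ∑ i ∈ A, ∑ j ∈ S \ A, w i j = ∑ i ∈ S \ A, ∑ j ∈ A, w i j := by
      rw [sum_comm]
      exact sum_congr rfl (fun i _ => sum_congr rfl (fun j _ => hs _ _))
    have e3 : 3 * (S \ A).card ≤ ∑ i ∈ S \ A, ∑ j ∈ A, w i j := by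
      have := Finset.card_nsmul_le_sum _ _ _ h2
      simpa [mul_comm] using this
    omega
  generalize (∑ i ∈ S \ A, ∑ j ∈ S \ A, w i j) = DR at *
  generalize (∑ i ∈ S, ∑ j ∈ S, w i j) = D at *
  generalize (S \ A).card = r at *
  have hn : 0 < S.card := card_pos.2 hne
  generalize S.card = n at *
  generalize A.card = a at *
  generalize A'.card = a' at *
  push Not at hgood
  zify at *
  have k0 : (r : ℤ) = n - a := by linarith
  have k1 : (n : ℤ) * D < r * (D + 3 * n) := by rw [k0]; nlinarith
  have k2 : 3 * (r : ℤ) ^ 2 ≤ a' * (D - 3 * r) := by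
    refine hcard.trans (mul_le_mul_of_nonneg_left (by linarith) (by positivity))
  have hr : (0 : ℤ) < r := by
    by_contra hcon
    have : (r : ℤ) = 0 := by omega
    rw [this] at k1
    have : (0 : ℤ) ≤ n * D := by positivity
    linarith
  have k4 : (0 : ℤ) < D - 3 * r := by
    have : (0 : ℤ) ≤ DR := by positivity
    linarith
  have k5 : 3 * (n : ℤ) ^ 2 * (D - 3 * r) ≤ 3 * r ^ 2 * (D + 3 * n) := by
    have q1 : (r : ℤ) * (n * D) ≤ r * (r * (D + 3 * n)) :=
      mul_le_mul_of_nonneg_left k1.le hr.le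
    have q2 : (n : ℤ) * (n * D) ≤ n * (r * (D + 3 * n)) :=
      mul_le_mul_of_nonneg_left k1.le hn.le
    nlinarith
  have k6 : 3 * (r : ℤ) ^ 2 * (D + 3 * n) ≤ a' * (D - 3 * r) * (D + 3 * n) :=
    mul_le_mul_of_nonneg_right k2 (by positivity)
  refine le_of_mul_le_mul_right ?_ k4
  calc 3 * (n : ℤ) ^ 2 * (D - 3 * r) ≤ _ := k5
    _ ≤ _ := k6
    _ = _ := by ring

section Key

variable {I : Type*} [Fintype I] [DecidableEq I]

lemma flipBit_flipSet_insert (x : I → Bool) (U : Finset I) (t : I) (ht : t ∉ U) :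
    flipBit (flipSet x U) t = flipSet x (insert t U) := by
  funext j
  by_cases h : j = t
  · subst h; simp [flipBit, flipSet, ht]
  · simp [flipBit, flipSet, h]

lemma flipBit_flipSet_erase (x : I → Bool) (U : Finset I) (t : I) (ht : t ∈ U) :
    flipBit (flipSet x U) t = flipSet x (U.erase t) := by
  funext j
  by_cases h : j = t
  · subst h; simp [flipBit, flipSet, ht]
  · simp [flipBit, flipSet, h]

/-- A family of blocks with few mutual contradictions produces a 0-input of high sensitivity. -/
lemma card_le_s0 {ι : Type*} [Fintype ι] [DecidableEq ι] (f : (I → Bool) → Bool) (x : I → Bool)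
    (hx : f x = false) (B Z : ι → Finset I)
    (hB : ∀ i j, i ≠ j → Disjoint (B i) (B j)) (hBZ : ∀ i, Disjoint (B i) (Z i))
    (hsat : ∀ i U, B i ⊆ U → Disjoint U (Z i) → f (flipSet x U) = true)
    (hdeg : ∀ i, (∑ p ∈ B i, (univ.filter fun j => p ∈ Z j).card)
      + (∑ p ∈ Z i, (univ.filter fun j => p ∈ B j).card) ≤ 2) :
    Fintype.card ι ≤ s0 f := by
  classical
  have hBu : ∀ i j p, p ∈ B i → p ∈ B j → i = j := by
    intro i j p hi hj
    by_contra hij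
    exact (Finset.disjoint_left.1 (hB i j hij)) hi hj
  have hBZ' : ∀ i p, p ∈ B i → p ∉ Z i := fun i p hi => Finset.disjoint_left.1 (hBZ i) hi
  let T : Finset I := univ.biUnion B
  let P : Finset I := univ.filter fun p => (∃ i, p ∈ B i) ∧ ∃ j, p ∈ Z j
  have hPm : ∀ p, p ∈ P ↔ (∃ i, p ∈ B i) ∧ ∃ j, p ∈ Z j := by intro p; simp [P]
  let N : I → Finset ι := fun p => univ.filter fun i => p ∈ B i ∨ p ∈ Z i
  have hone : ∀ i, (P ∩ B i).card ≤ ∑ p ∈ B i, (univ.filter fun j => p ∈ Z j).card := by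
    intro i
    calc (P ∩ B i).card = ∑ p ∈ P ∩ B i, 1 := by simp
      _ ≤ ∑ p ∈ P ∩ B i, (univ.filter fun j => p ∈ Z j).card := by
          refine sum_le_sum fun p hp => ?_
          obtain ⟨j, hj⟩ := ((hPm p).1 (mem_inter.1 hp).1).2
          exact card_pos.2 ⟨j, by simpa using hj⟩
      _ ≤ _ := sum_le_sum_of_subset inter_subset_right
  have htwo : ∀ i, (P ∩ Z i).card ≤ ∑ p ∈ Z i, (univ.filter fun j => p ∈ B j).card := by
    intro i
    calc (P ∩ Z i).card = ∑ p ∈ P ∩ Z i, 1 := by simp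
      _ ≤ ∑ p ∈ P ∩ Z i, (univ.filter fun j => p ∈ B j).card := by
          refine sum_le_sum fun p hp => ?_
          obtain ⟨j, hj⟩ := ((hPm p).1 (mem_inter.1 hp).1).1
          exact card_pos.2 ⟨j, by simpa using hj⟩
      _ ≤ _ := sum_le_sum_of_subset inter_subset_right
  obtain ⟨g, ginj, hg⟩ : ∃ g : P → ι, Function.Injective g ∧ ∀ p : P, g p ∈ N p := by
    refine (Finset.all_card_le_biUnion_card_iff_exists_injective (fun p : P => N p)).1 ?_
    intro X
    have := Finset.card_mul_le_card_mul (s := X) (t := X.biUnion fun p => N p)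
      (fun (p : P) i => i ∈ N p) (m := 2) (n := 2) ?_ ?_
    · omega
    · intro p hp
      obtain ⟨⟨i, hi⟩, ⟨j, hj⟩⟩ := (hPm p).1 p.2
      have hij : i ≠ j := by
        rintro rfl
        exact hBZ' _ _ hi hj
      rw [← card_pair hij]
      apply card_le_card
      intro k hk
      rw [mem_bipartiteAbove, mem_biUnion]
      have : k ∈ N p := by
        rw [mem_insert, mem_singleton] at hk
        rcases hk with rfl | rfl
        · simp [N, hi]
        · simp [N, hj]
      exact ⟨⟨p, hp, this⟩, this⟩
    · intro i _
      calc _ = ((X.bipartiteBelow (fun (p : P) i => i ∈ N p) i).map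
              (Function.Embedding.subtype _)).card := by rw [card_map]
        _ ≤ ((P ∩ B i) ∪ (P ∩ Z i)).card := by
            apply card_le_card
            intro p hp
            simp only [mem_map, mem_bipartiteBelow, Function.Embedding.subtype_apply] at hp
            obtain ⟨q, ⟨_, hq⟩, rfl⟩ := hp
            simp only [N, mem_filter, mem_univ, true_and] at hq
            simp only [mem_union, mem_inter]
            rcases hq with hq | hq
            · exact Or.inl ⟨q.2, hq⟩
            · exact Or.inr ⟨q.2, hq⟩
        _ ≤ _ := card_union_le _ _
        _ ≤ _ := add_le_add (hone i) (htwo i)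
        _ ≤ 2 := hdeg i
  -- double points
  let Dbl : I → Prop := fun p => 2 ≤ (univ.filter fun j => p ∈ Z j).card
  let X : Finset I := univ.filter fun p => Dbl p ∨ ∃ h : p ∈ P, p ∈ B (g ⟨p, h⟩)
  have hXm : ∀ p, p ∈ X ↔ Dbl p ∨ ∃ h : p ∈ P, p ∈ B (g ⟨p, h⟩) := by intro p; simp [X]
  obtain ⟨U, hUm, hUmax⟩ := Finset.exists_max_image
    ((T \ X).powerset.filter fun U => f (flipSet x U) = false) Finset.card
    ⟨∅, by
      have : flipSet x ∅ = x := by funext j; simp [flipSet]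
      simp [this, hx]⟩
  rw [mem_filter, mem_powerset] at hUm
  obtain ⟨hUT, hU0⟩ := hUm
  have hmax : ∀ t, t ∉ U → t ∈ T → t ∉ X → f (flipSet x (insert t U)) = true := by
    intro t ht htT htX
    by_contra hcon
    have := hUmax (insert t U) (by
      rw [mem_filter, mem_powerset]
      exact ⟨insert_subset (mem_sdiff.2 ⟨htT, htX⟩) hUT, by simpa using hcon⟩)
    rw [card_insert_of_notMem ht] at this
    omega
  -- elements of U in some Z i
  have hUZ : ∀ i p, p ∈ U → p ∈ Z i → ∃ h : p ∈ P, g ⟨p, h⟩ = i := by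
    intro i p hpU hpZ
    have h1 := mem_sdiff.1 (hUT hpU)
    have hpT : ∃ k, p ∈ B k := by simpa [T] using h1.1
    have hpP : p ∈ P := (hPm p).2 ⟨hpT, i, hpZ⟩
    refine ⟨hpP, ?_⟩
    have h2 := h1.2
    rw [hXm] at h2
    push Not at h2
    have h3 := hg ⟨p, hpP⟩
    simp only [N, mem_filter, mem_univ, true_and] at h3
    have h4 : p ∈ Z (g ⟨p, hpP⟩) := h3.resolve_left (h2.2 hpP)
    have h5 : (univ.filter fun j => p ∈ Z j).card ≤ 1 := by
      have := h2.1
      simp only [Dbl] at this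
      omega
    exact card_le_one.1 h5 _ (by simpa using h4) _ (by simpa using hpZ)
  -- uniqueness
  let Q : ι → I → Prop := fun i p => (p ∈ B i ∧ p ∈ X) ∨ (p ∈ U ∧ p ∈ Z i)
  have hQP : ∀ i p, Q i p → p ∈ P ∧ (p ∈ B i ∨ p ∈ Z i) := by
    rintro i p (⟨h1, h2⟩ | ⟨h1, h2⟩)
    · refine ⟨?_, Or.inl h1⟩
      rcases (hXm p).1 h2 with h | ⟨h, _⟩
      · have : 0 < (univ.filter fun j => p ∈ Z j).card := by
          simp only [Dbl] at h; omega
        obtain ⟨j, hj⟩ := card_pos.1 this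
        exact (hPm p).2 ⟨⟨i, h1⟩, j, by simpa using hj⟩
      · exact h
    · exact ⟨(hUZ i p h1 h2).1, Or.inr h2⟩
  have hQg : ∀ i p, Q i p → (p ∈ B i ∧ Dbl p) ∨ ∃ h : p ∈ P, g ⟨p, h⟩ = i := by
    rintro i p (⟨h1, h2⟩ | ⟨h1, h2⟩)
    · rcases (hXm p).1 h2 with h | ⟨h, h'⟩
      · exact Or.inl ⟨h1, h⟩
      · exact Or.inr ⟨h, hBu _ _ p h' h1⟩
    · exact Or.inr (hUZ i p h1 h2)
  have hdbl : ∀ i p q, p ∈ B i → Dbl p → q ∈ P → (q ∈ B i ∨ q ∈ Z i) → p = q := by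
    intro i p q hp hD hqP hq
    by_contra hpq
    have hd := hdeg i
    simp only [Dbl] at hD
    rcases hq with hq | hq
    · obtain ⟨j, hj⟩ := ((hPm q).1 hqP).2
      have h1 : 0 < (univ.filter fun j => q ∈ Z j).card := card_pos.2 ⟨j, by simpa using hj⟩
      have h2 : ∑ r ∈ {p, q}, (univ.filter fun j => r ∈ Z j).card
          ≤ ∑ r ∈ B i, (univ.filter fun j => r ∈ Z j).card := by
        apply sum_le_sum_of_subset
        intro r hr
        rw [mem_insert, mem_singleton] at hr
        rcases hr with rfl | rfl <;> assumption
      rw [sum_pair hpq] at h2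
      omega
    · have h1 : 0 < (P ∩ Z i).card := card_pos.2 ⟨q, mem_inter.2 ⟨hqP, hq⟩⟩
      have h2 := htwo i
      have h3 := single_le_sum (f := fun r => (univ.filter fun j => r ∈ Z j).card)
        (fun _ _ => Nat.zero_le _) hp
      omega
  have hQu : ∀ i p q, Q i p → Q i q → p = q := by
    intro i p q hp hq
    rcases hQg i p hp with ⟨h1, h2⟩ | ⟨h1, h2⟩
    · exact hdbl i p q h1 h2 (hQP i q hq).1 (hQP i q hq).2
    rcases hQg i q hq with ⟨h3, h4⟩ | ⟨h3, h4⟩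
    · exact (hdbl i q p h3 h4 (hQP i p hp).1 (hQP i p hp).2).symm
    have := ginj (h2.trans h4.symm)
    simpa using this
  have hex : ∀ i, ∃ t, f (flipBit (flipSet x U) t) = true ∧
      ((t ∈ B i ∧ t ∉ U) ∨ (t ∈ U ∧ t ∈ Z i)) := by
    intro i
    by_cases hc1 : ∃ t ∈ B i, t ∉ U ∧ t ∉ X
    · obtain ⟨t, h1, h2, h3⟩ := hc1
      refine ⟨t, ?_, Or.inl ⟨h1, h2⟩⟩
      rw [flipBit_flipSet_insert _ _ _ h2]
      exact hmax t h2 (mem_biUnion.2 ⟨i, mem_univ _, h1⟩) h3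
    push Not at hc1
    by_cases hc2 : B i ⊆ U
    · have : ¬ Disjoint U (Z i) := by
        intro hdis
        rw [hsat i U hc2 hdis] at hU0
        simp at hU0
      obtain ⟨q, hqU, hqZ⟩ := Finset.not_disjoint_iff.1 this
      refine ⟨q, ?_, Or.inr ⟨hqU, hqZ⟩⟩
      rw [flipBit_flipSet_erase _ _ _ hqU]
      apply hsat i
      · intro r hr
        refine mem_erase.2 ⟨?_, hc2 hr⟩
        rintro rfl
        exact hBZ' i _ hr hqZ
      · rw [Finset.disjoint_left]
        intro r hr hrZ
        rw [mem_erase] at hr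
        exact hr.1 (hQu i r q (Or.inr ⟨hr.2, hrZ⟩) (Or.inr ⟨hqU, hqZ⟩))
    · obtain ⟨t, htB, htU⟩ := Finset.not_subset.1 hc2
      have hQt : Q i t := Or.inl ⟨htB, hc1 t htB htU⟩
      refine ⟨t, ?_, Or.inl ⟨htB, htU⟩⟩
      rw [flipBit_flipSet_insert _ _ _ htU]
      apply hsat i
      · intro r hr
        by_cases hrU : r ∈ U
        · exact mem_insert_of_mem hrU
        · rw [hQu i r t (Or.inl ⟨hr, hc1 r hr hrU⟩) hQt]
          exact mem_insert_self _ _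
      · rw [Finset.disjoint_left]
        intro r hr hrZ
        rw [mem_insert] at hr
        rcases hr with rfl | hr
        · exact hBZ' i _ htB hrZ
        · have := hQu i r t (Or.inr ⟨hr, hrZ⟩) hQt
          subst this
          exact htU hr
  choose t ht1 ht2 using hex
  have htinj : Function.Injective t := by
    intro i j hij
    rcases ht2 i with ⟨h1, h2⟩ | ⟨h1, h2⟩ <;> rcases ht2 j with ⟨h3, h4⟩ | ⟨h3, h4⟩
    · rw [← hij] at h3
      exact hBu _ _ _ h1 h3
    · rw [← hij] at h3; exact absurd h3 h2
    · rw [← hij] at h4; exact absurd h1 h4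
    · rw [← hij] at h3 h4
      obtain ⟨_, e1⟩ := hUZ i _ h1 h2
      obtain ⟨_, e2⟩ := hUZ j _ h3 h4
      exact e1.symm.trans e2
  have hcard : Fintype.card ι ≤ sens f (flipSet x U) := by
    rw [← Finset.card_univ, ← Finset.card_image_of_injective _ htinj]
    apply card_le_card
    intro p hp
    obtain ⟨i, _, rfl⟩ := mem_image.1 hp
    simp [ht1 i, hU0]
  exact hcard.trans (Finset.le_sup (f := sens f) (by simpa using hU0))

end Key

theorem stmt_0_aux {n : ℕ} (f : (Fin n → Bool) → Bool) (hne : ¬ ∀ x, f x = true) :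
    3 * bs0 f ≤ (2 * C1 f + 1) * s0 f := by
  classical
  push Not at hne
  obtain ⟨x0, hx0⟩ := hne
  obtain ⟨x, hxm, hxe⟩ := Finset.exists_mem_eq_sup
    (univ.filter fun x => f x = false) ⟨x0, by simpa using hx0⟩ (bs f)
  have hx : f x = false := by simpa using hxm
  have hnonempty : ∀ U : Finset (Fin n), f (flipSet x U) ≠ f x → U.Nonempty := by
    intro U h
    by_contra hcon
    rw [not_nonempty_iff_eq_empty] at hcon
    subst hcon
    exact h (congrArg f (by funext j; simp [flipSet]))
  have hmem : hasBS f x (bs f x) := by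
    refine Nat.sSup_mem (s := {b | hasBS f x b}) ⟨0, fun i => i.elim0, fun i => i.elim0,
      fun i => i.elim0⟩ ⟨n, ?_⟩
    rintro b ⟨B, hB, hf⟩
    choose t ht using fun i => hnonempty _ (hf i)
    have : Function.Injective t := by
      intro i j hij
      by_contra hne
      refine (Finset.disjoint_left.1 (hB i j hne)) (ht i) ?_
      rw [hij]; exact ht j
    simpa using Fintype.card_le_of_injective t this
  have hb : bs0 f = bs f x := hxe
  rw [hb]
  obtain ⟨B, hB, hf⟩ := hmem
  generalize bs f x = b at *
  have hf1 : ∀ i, f (flipSet x (B i)) = true := by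
    intro i; have := hf i; rw [hx] at this; simpa using this
  have hcert : ∀ i, ∃ S : Finset (Fin n), S.card ≤ C1 f ∧
      IsCertOn f S (flipSet x (B i)) true := by
    intro i
    have hm := Nat.sInf_mem (s := {m | ∃ S : Finset (Fin n), S.card = m ∧
      IsCertOn f S (flipSet x (B i)) (f (flipSet x (B i)))}) ⟨_, univ, rfl, by
        intro y hy
        exact congrArg f (funext fun j => hy j (mem_univ _))⟩
    obtain ⟨S, hS, hc⟩ := hm
    refine ⟨S, ?_, by rw [hf1 i] at hc; exact hc⟩
    rw [hS]
    exact Finset.le_sup (f := certSize f) (by simpa using hf1 i)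
  choose S hSc hS using hcert
  let Z : Fin b → Finset (Fin n) := fun i => S i \ B i
  have hsat : ∀ i U, B i ⊆ U → Disjoint U (Z i) → f (flipSet x U) = true := by
    intro i U h1 h2
    apply hS i
    intro j hj
    by_cases hjB : j ∈ B i
    · simp [flipSet, hjB, h1 hjB]
    · have : j ∉ U := fun hjU => (Finset.disjoint_left.1 h2) hjU (mem_sdiff.2 ⟨hj, hjB⟩)
      simp [flipSet, hjB, this]
  have hZc : ∀ i, (Z i).card + 1 ≤ C1 f := by
    intro i
    have : Z i ⊂ S i := by
      refine ⟨sdiff_subset, fun hsub => ?_⟩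
      have : f x = true := by
        apply hS i
        intro j hj
        have := (mem_sdiff.1 (hsub hj)).2
        simp [flipSet, this]
      rw [hx] at this
      simp at this
    exact (card_lt_card this).trans_le (hSc i)
  have hBZ : ∀ i, Disjoint (B i) (Z i) := fun i => disjoint_sdiff
  let w : Fin b → Fin b → ℕ := fun i j => (B i ∩ Z j).card + (B j ∩ Z i).card
  obtain ⟨A, -, hdeg, hcard⟩ := turan_two w (fun i j => Nat.add_comm _ _)
    (fun i => by simp [w, Finset.disjoint_iff_inter_eq_empty.1 (hBZ i)]) univ
  have hAs : A.card ≤ s0 f := by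
    have := card_le_s0 (ι := A) f x hx (fun i => B i) (fun i => Z i)
      (fun i j hij => hB _ _ (fun h => hij (Subtype.ext h))) (fun i => hBZ i)
      (fun i => hsat i) ?_
    · simpa using this
    intro i
    have key : ∀ (s : Finset (Fin n)) (Y : Fin b → Finset (Fin n)),
        ∑ p ∈ s, (univ.filter fun j : A => p ∈ Y j).card = ∑ j ∈ A, (s ∩ Y j).card := by
      intro s Y
      rw [← Finset.sum_coe_sort A (fun j => (s ∩ Y j).card)]
      have := Finset.sum_card_bipartiteAbove_eq_sum_card_bipartiteBelow
        (s := s) (t := (univ : Finset A)) (fun p (j : A) => p ∈ Y j)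
      simp only [bipartiteAbove, bipartiteBelow, Finset.filter_mem_eq_inter] at this
      exact this
    rw [key, key, ← sum_add_distrib]
    refine le_trans (le_of_eq (sum_congr rfl fun j _ => ?_)) (hdeg i i.2)
    simp only [w]
    rw [inter_comm (Z i)]
  have htot : (∑ i, ∑ j, w i j) + 2 * b ≤ 2 * (b * C1 f) := by
    have e1 : ∑ i, ∑ j, w i j = 2 * ∑ j, ∑ i, (B i ∩ Z j).card := by
      simp only [w, sum_add_distrib]
      rw [sum_comm]
      ring
    have e2 : ∀ j, ∑ i, (B i ∩ Z j).card ≤ (Z j).card := by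
      intro j
      rw [← card_biUnion]
      · exact card_le_card (biUnion_subset.2 fun i _ => inter_subset_right)
      · intro i _ k _ hik
        exact (hB i k hik).mono inter_subset_left inter_subset_left
    have e3 : ∑ j : Fin b, ((∑ i, (B i ∩ Z j).card) + 1) ≤ ∑ _j : Fin b, C1 f :=
      sum_le_sum fun j _ => (Nat.add_le_add_right (e2 j) 1).trans (hZc j)
    rw [sum_add_distrib] at e3
    simp at e3
    omega
  rcases Nat.eq_zero_or_pos b with rfl | hbpos
  · simp
  simp only [card_univ, Fintype.card_fin] at hcard
  have h3 : 3 * b ^ 2 ≤ s0 f * (b * (2 * C1 f + 1)) :=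
    hcard.trans (Nat.mul_le_mul hAs (by nlinarith))
  refine Nat.le_of_mul_le_mul_left ?_ hbpos
  calc b * (3 * b) = 3 * b ^ 2 := by ring
    _ ≤ _ := h3
    _ = _ := by ring

/-- For any Boolean function `f` that is not constantly 1,
`C_1(f) ≥ (3/2)·bs_0(f)/s_0(f) − 1/2`. -/
theorem stmt_0 {n : ℕ} (f : (Fin n → Bool) → Bool) (hne : ¬ ∀ x, f x = true) :
    (C1 f : ℚ) ≥ 3 / 2 * (bs0 f : ℚ) / (s0 f : ℚ) - 1 / 2 := by
  have h := stmt_0_aux f hne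
  have hC : (0 : ℚ) ≤ C1 f := by positivity
  have h' : 3 * (bs0 f : ℚ) ≤ (2 * C1 f + 1) * s0 f := by exact_mod_cast h
  rcases Nat.eq_zero_or_pos (s0 f) with h0 | h0
  · rw [h0]
    simp
    linarith
  · have h0' : (0 : ℚ) < s0 f := by exact_mod_cast h0
    have : 3 / 2 * (bs0 f : ℚ) / (s0 f : ℚ) ≤ C1 f + 1 / 2 := by
      rw [div_le_iff₀ h0']
      linarith
    linarith
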